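/- There exists a sequence of sets Y_0 ≤_T Y_1 ≤_T Y_2 ≤_T ⋯ such that for every e: ∅' ≰_T Y_e, and every set that is Δ⁰₂ relative to Y_e (equivalently, the limit set of every Y_e-computable stable coloring) has an infinite subset or infinite cosubset computable in Y_{e+1}. Consequently, the Turing ideal { S : S ≤_T Y_e for some e } is an ω-model of the principle SRAM that contains no set of degree 0'. -/

import Mathlib

/-!
Preamble: oracle computability, Turing reducibility, the jump, martingales,
and Martin-Löf randomness, developed from scratch.
-/

open scoped Classical

/-- The characteristic function of a set of naturals. -/
noncomputable def chi (A : Set ℕ) : ℕ → ℕ :=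
  fun n => if n ∈ A then 1 else 0

/-- Partial functions recursive in a (total) oracle `O : ℕ → ℕ`.
This mirrors `Nat.Partrec`, with an additional constructor for the oracle. -/
inductive RecIn (O : ℕ → ℕ) : (ℕ →. ℕ) → Prop
  | oracle : RecIn O (fun n => Part.some (O n))
  | zero : RecIn O (fun _ => Part.some 0)
  | succ : RecIn O (fun n => Part.some (n + 1))
  | left : RecIn O (fun n => Part.some (Nat.unpair n).1)
  | right : RecIn O (fun n => Part.some (Nat.unpair n).2)
  | pair {f g} : RecIn O f → RecIn O g → RecIn O (fun n => Nat.pair <$> f n <*> g n)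
  | comp {f g} : RecIn O f → RecIn O g → RecIn O (fun n => g n >>= f)
  | prec {f g} :
      RecIn O f → RecIn O g →
      RecIn O
        (Nat.unpaired fun a n =>
          n.rec (f a) fun y IH => do
            let i ← IH
            g (Nat.pair a (Nat.pair y i)))
  | rfind {f} :
      RecIn O f →
      RecIn O (fun a => Nat.rfind fun n => (fun m => m = 0) <$> f (Nat.pair a n))

/-- Codes for oracle machines. -/
inductive OCode : Type
  | zero : OCode
  | succ : OCode
  | left : OCode
  | right : OCode
  | oracle : OCode
  | pair : OCode → OCode → OCode
  | comp : OCode → OCode → OCode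
  | prec : OCode → OCode → OCode
  | rfind' : OCode → OCode

/-- Evaluation of oracle codes relative to a total oracle. -/
def evalo (O : ℕ → ℕ) : OCode → ℕ →. ℕ
  | .zero => fun _ => Part.some 0
  | .succ => fun n => Part.some (n + 1)
  | .left => fun n => Part.some (Nat.unpair n).1
  | .right => fun n => Part.some (Nat.unpair n).2
  | .oracle => fun n => Part.some (O n)
  | .pair cf cg => fun n => Nat.pair <$> evalo O cf n <*> evalo O cg n
  | .comp cf cg => fun n => evalo O cg n >>= evalo O cf
  | .prec cf cg =>
      Nat.unpaired fun a n =>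
        n.rec (evalo O cf a) fun y IH => do
          let i ← IH
          evalo O cg (Nat.pair a (Nat.pair y i))
  | .rfind' cf =>
      Nat.unpaired fun a m =>
        (Nat.rfind fun n => (fun x => x = 0) <$> evalo O cf (Nat.pair a (n + m))).map (· + m)

/-- A surjective listing of oracle codes. -/
def ofNatOCode : ℕ → OCode
  | 0 => .zero
  | 1 => .succ
  | 2 => .left
  | 3 => .right
  | 4 => .oracle
  | n + 5 =>
    have hm : n.div2.div2 < n + 5 := by
      rw [Nat.div2_val, Nat.div2_val]
      exact lt_of_le_of_lt (le_trans (Nat.div_le_self _ _) (Nat.div_le_self _ _))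
        (Nat.lt_succ_of_le (Nat.le_add_right _ 4))
    have _m1 : n.div2.div2.unpair.1 < n + 5 :=
      lt_of_le_of_lt (Nat.unpair_left_le _) hm
    have _m2 : n.div2.div2.unpair.2 < n + 5 :=
      lt_of_le_of_lt (Nat.unpair_right_le _) hm
    match n.bodd, n.div2.bodd with
    | false, false => .pair (ofNatOCode n.div2.div2.unpair.1) (ofNatOCode n.div2.div2.unpair.2)
    | false, true  => .comp (ofNatOCode n.div2.div2.unpair.1) (ofNatOCode n.div2.div2.unpair.2)
    | true , false => .prec (ofNatOCode n.div2.div2.unpair.1) (ofNatOCode n.div2.div2.unpair.2)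
    | true , true  => .rfind' (ofNatOCode n.div2.div2)

/-- `Phi O e` is the `e`-th partial `O`-computable function `Φ_e^O`. -/
def Phi (O : ℕ → ℕ) (e : ℕ) : ℕ →. ℕ := evalo O (ofNatOCode e)

/-- The Turing jump `A'` of a set `A`. -/
noncomputable def jump (A : Set ℕ) : Set ℕ := {e | (Phi (chi A) e e).Dom}

/-- The halting set `∅'`. -/
noncomputable def K : Set ℕ := jump ∅

/-- Turing reducibility between sets: `TRed B A` means `B ≤_T A`. -/
noncomputable def TRed (B A : Set ℕ) : Prop :=
  RecIn (chi A) (fun n => Part.some (chi B n))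

/-- The effective join of two sets. -/
def join (A B : Set ℕ) : Set ℕ :=
  {n | (∃ a ∈ A, n = 2 * a) ∨ (∃ b ∈ B, n = 2 * b + 1)}

/-- A set is low if its jump is Turing reducible to `∅'`. -/
noncomputable def Low (L : Set ℕ) : Prop := TRed (jump L) K

/-- The function `f : α → β` presented as an oracle on `ℕ`, via the encodings. -/
def fnOracle {α β : Type} [Encodable α] [Encodable β] (f : α → β) : ℕ → ℕ :=
  fun n => Encodable.encode ((Encodable.decode (α := α) n).map f)

/-- `FRed f A` means the function `f` is Turing reducible to the set `A`. -/
noncomputable def FRed {α β : Type} [Encodable α] [Encodable β] (f : α → β) (A : Set ℕ) : Prop :=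
  RecIn (chi A) (fun n => Part.some (fnOracle f n))

/-- `FFRed g f` means the function `g` is Turing reducible to the function `f`. -/
def FFRed {α β γ δ : Type} [Encodable α] [Encodable β] [Encodable γ] [Encodable δ]
    (g : γ → δ) (f : α → β) : Prop :=
  RecIn (fnOracle f) (fun n => Part.some (fnOracle g n))

/-- A martingale: a nonnegative rational-valued function on finite binary strings
satisfying the averaging condition `2 M(σ) = M(σ0) + M(σ1)`. -/
def IsMartingale (M : List Bool → ℚ) : Prop :=
  (∀ σ, 0 ≤ M σ) ∧ ∀ σ, 2 * M σ = M (σ ++ [false]) + M (σ ++ [true])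

/-- The length-`n` initial segment of the characteristic sequence of `A`. -/
noncomputable def seg (A : Set ℕ) (n : ℕ) : List Bool :=
  (List.range n).map fun i => if i ∈ A then true else false

/-- A martingale succeeds on a set `A` if `limsup_n M(A↾n) = ∞`. -/
noncomputable def Succeeds (M : List Bool → ℚ) (A : Set ℕ) : Prop :=
  ∀ q : ℚ, ∃ n, q < M (seg A n)

/-- `H(A)`: the mass problem of infinite subsets or cosubsets of `A`. -/
def Hset (A : Set ℕ) : Set (Set ℕ) :=
  {S | S.Infinite ∧ (S ⊆ A ∨ S ⊆ Aᶜ)}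

/-- Muchnik reducibility: `MuchnikLe P Q` iff every member of `Q` computes a member of `P`. -/
noncomputable def MuchnikLe (P Q : Set (Set ℕ)) : Prop :=
  ∀ B ∈ Q, ∃ A ∈ P, TRed A B

/-- A set of naturals is computably enumerable. -/
def CE (W : Set ℕ) : Prop :=
  ∃ g : ℕ →. ℕ, RecIn (fun _ => 0) g ∧ ∀ n, n ∈ W ↔ (g n).Dom

/-- A Martin-Löf test: a uniformly c.e. sequence of sets of strings `U n`,
with the open set generated by `U n` having measure at most `2^{-n}`. -/
def MLTest (U : ℕ → Set (List Bool)) : Prop :=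
  CE {p : ℕ | ∃ σ ∈ U (Nat.unpair p).1, (Nat.unpair p).2 = Encodable.encode σ} ∧
  ∀ n, (∑' σ : (U n), ((1 : ENNReal) / 2) ^ (σ : List Bool).length) ≤ (1 / 2) ^ n

/-- A set is 1-random (Martin-Löf random) if for every Martin-Löf test there is
an `n` such that no initial segment of the set lies in `U n`. -/
noncomputable def MLRandom (A : Set ℕ) : Prop :=
  ∀ U : ℕ → Set (List Bool), MLTest U → ∃ n, ∀ m, seg A m ∉ U n

section

section EOsec
variable {α β : Type} [Primcodable α] [Primcodable β]

def EO {α : Type} [Primcodable α] (P : Set ℕ → α → Prop) : Prop :=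
  ∃ R : List Bool → α → Prop, PrimrecRel R ∧ (∀ σ τ a, σ <+: τ → R σ a → R τ a) ∧
    ∀ X a, P X a ↔ ∃ k, R (seg X k) a

theorem seg_length (X : Set ℕ) (k : ℕ) : (seg X k).length = k := by simp [seg]

theorem seg_prefix (X : Set ℕ) {k l : ℕ} (h : k ≤ l) : seg X k <+: seg X l := by
  unfold seg
  obtain ⟨d, rfl⟩ := Nat.exists_eq_add_of_le h
  rw [List.range_add, List.map_append]
  exact List.prefix_append _ _

theorem seg_get (X : Set ℕ) (k i : ℕ) (h : i < k) : (seg X k)[i]? = some (decide (i ∈ X)) := by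
  simp [seg, h]

theorem seg_congr {X Y : Set ℕ} {k : ℕ} (h : ∀ i < k, (i ∈ X ↔ i ∈ Y)) : seg X k = seg Y k := by
  unfold seg
  apply List.map_congr_left
  intro i hi
  simp [h i (List.mem_range.1 hi)]

theorem EO.congr {P Q : Set ℕ → α → Prop} (hP : EO P) (h : ∀ X a, Q X a ↔ P X a) : EO Q := by
  have : Q = P := by funext X a; exact propext (h X a)
  rwa [this]

/-- finite use -/
theorem EO.use {P : Set ℕ → α → Prop} (hP : EO P) {X : Set ℕ} {a : α} (h : P X a) :
    ∃ k, ∀ Y : Set ℕ, (∀ i < k, (i ∈ X ↔ i ∈ Y)) → P Y a := by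
  obtain ⟨R, -, -, hR⟩ := hP
  obtain ⟨k, hk⟩ := (hR X a).1 h
  exact ⟨k, fun Y hY => (hR Y a).2 ⟨k, seg_congr hY ▸ hk⟩⟩

theorem EO.prim {p : α → Prop} (hp : PrimrecPred p) : EO (fun _ a => p a) :=
  ⟨fun _ a => p a, hp.comp Primrec.snd, fun _ _ _ _ h => h, fun _ _ => by simp⟩

theorem EO.and {P Q : Set ℕ → α → Prop} (hP : EO P) (hQ : EO Q) : EO (fun X a => P X a ∧ Q X a) := by
  obtain ⟨R, h1, h2, h3⟩ := hP
  obtain ⟨R', h1', h2', h3'⟩ := hQ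
  refine ⟨fun σ a => R σ a ∧ R' σ a, PrimrecPred.and h1 h1', fun σ τ a h h' => ⟨h2 _ _ _ h h'.1, h2' _ _ _ h h'.2⟩, ?_⟩
  intro X a
  beta_reduce
  rw [h3, h3']
  constructor
  · rintro ⟨⟨k, hk⟩, ⟨l, hl⟩⟩
    exact ⟨max k l, h2 _ _ _ (seg_prefix X (le_max_left _ _)) hk, h2' _ _ _ (seg_prefix X (le_max_right _ _)) hl⟩
  · rintro ⟨k, h, h'⟩; exact ⟨⟨k, h⟩, ⟨k, h'⟩⟩

theorem EO.or {P Q : Set ℕ → α → Prop} (hP : EO P) (hQ : EO Q) : EO (fun X a => P X a ∨ Q X a) := by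
  obtain ⟨R, h1, h2, h3⟩ := hP
  obtain ⟨R', h1', h2', h3'⟩ := hQ
  refine ⟨fun σ a => R σ a ∨ R' σ a, PrimrecPred.or h1 h1', fun σ τ a h h' => h'.imp (h2 _ _ _ h) (h2' _ _ _ h), ?_⟩
  intro X a
  beta_reduce
  rw [h3, h3', exists_or]

theorem EO.comp {P : Set ℕ → β → Prop} (hP : EO P) {g : α → β} (hg : Primrec g) :
    EO (fun X a => P X (g a)) := by
  obtain ⟨R, h1, h2, h3⟩ := hP
  exact ⟨fun σ a => R σ (g a), h1.comp Primrec.fst (hg.comp Primrec.snd),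
    fun σ τ a h h' => h2 _ _ _ h h', fun X a => h3 X (g a)⟩

theorem EO.ex {P : Set ℕ → α → β → Prop} (hP : EO (fun X (p : α × β) => P X p.1 p.2)) :
    EO (fun X a => ∃ b, P X a b) := by
  obtain ⟨R, h1, h2, h3⟩ := hP
  refine ⟨fun σ a => ∃ n < σ.length, ∃ b, Encodable.decode (α := β) n = some b ∧ R σ (a, b), ?_, ?_, ?_⟩
  · have hq : PrimrecRel (fun (n : ℕ) (p : List Bool × α) =>
        ∃ b, Encodable.decode (α := β) n = some b ∧ R p.1 (p.2, b)) := by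
      have : Primrec (fun q : ℕ × (List Bool × α) => (Option.casesOn (Encodable.decode (α := β) q.1) false
          (fun b => decide (R q.2.1 (q.2.2, b))) : Bool)) := by
        refine Primrec.option_casesOn (Primrec.decode.comp Primrec.fst) (Primrec.const false) ?_
        exact h1.decide.comp (Primrec.fst.comp (Primrec.snd.comp Primrec.fst))
          (Primrec.pair (Primrec.snd.comp (Primrec.snd.comp Primrec.fst)) Primrec.snd)
      refine ⟨inferInstance, this.of_eq ?_⟩
      rintro ⟨n, σ, a⟩
      cases h : Encodable.decode (α := β) n <;> simp [h]
    exact (hq.exists_mem_list.comp (f := fun p : List Bool × α => List.range p.1.length) (g := fun p => p)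
      (Primrec.list_range.comp (Primrec.list_length.comp Primrec.fst)) Primrec.id).of_eq (by simp)
  · rintro σ τ a h ⟨n, hn, b, hb, hR⟩
    exact ⟨n, lt_of_lt_of_le hn h.length_le, b, hb, h2 _ _ _ h hR⟩
  · intro X a
    constructor
    · rintro ⟨b, hb⟩
      obtain ⟨k, hk⟩ := (h3 X (a, b)).1 hb
      refine ⟨max k (Encodable.encode b + 1), Encodable.encode b, ?_, b, Encodable.encodek b, h2 _ _ _ (seg_prefix X (le_max_left _ _)) hk⟩
      rw [seg_length]; omega
    · rintro ⟨k, n, -, b, -, h⟩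
      exact ⟨b, (h3 X (a, b)).2 ⟨k, h⟩⟩

theorem EO.all_mem {P : Set ℕ → α → β → Prop} (hP : EO (fun X (p : α × β) => P X p.1 p.2))
    {g : α → List β} (hg : Primrec g) :
    EO (fun X a => ∀ b ∈ g a, P X a b) := by
  obtain ⟨R, h1, h2, h3⟩ := hP
  refine ⟨fun σ a => ∀ b ∈ g a, R σ (a, b), ?_, ?_, ?_⟩
  · have hq : PrimrecRel (fun (b : β) (p : List Bool × α) => R p.1 (p.2, b)) :=
      h1.comp (Primrec.fst.comp Primrec.snd) (Primrec.pair (Primrec.snd.comp Primrec.snd) Primrec.fst)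
    exact hq.forall_mem_list.comp (hg.comp Primrec.snd) Primrec.id
  · intro σ τ a h h' b hb
    exact h2 _ _ _ h (h' b hb)
  · intro X a
    have h3' : ∀ b, P X a b ↔ ∃ k, R (seg X k) (a, b) := fun b => h3 X (a, b)
    simp only [h3']
    generalize g a = l
    constructor
    · intro h
      induction l with
      | nil => exact ⟨0, by simp⟩
      | cons c l ih =>
        obtain ⟨k, hk⟩ := ih (fun b hb => h b (List.mem_cons_of_mem _ hb))
        obtain ⟨k', hk'⟩ := h c List.mem_cons_self
        refine ⟨max k k', ?_⟩
        intro b hb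
        rcases List.mem_cons.1 hb with rfl | hb
        · exact h2 _ _ _ (seg_prefix X (le_max_right _ _)) hk'
        · exact h2 _ _ _ (seg_prefix X (le_max_left _ _)) (hk b hb)
    · rintro ⟨k, hk⟩ b hb
      exact ⟨k, hk b hb⟩

theorem EO.all_lt {P : Set ℕ → α → ℕ → Prop} (hP : EO (fun X (p : α × ℕ) => P X p.1 p.2))
    {g : α → ℕ} (hg : Primrec g) :
    EO (fun X a => ∀ b < g a, P X a b) :=
  (hP.all_mem (Primrec.list_range.comp hg)).congr (by simp)

theorem EO.mem' (v : Bool) : EO (fun X (n : ℕ) => decide (n ∈ X) = v) := by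
  refine ⟨fun σ n => σ[n]? = some v, Primrec.eq.comp (Primrec.list_getElem?.comp Primrec.fst Primrec.snd) (Primrec.const _), ?_, ?_⟩
  · rintro σ τ n ⟨ρ, rfl⟩ h
    have : n < σ.length := by
      by_contra hh
      rw [List.getElem?_eq_none (by omega)] at h; simp at h
    rw [List.getElem?_append_left this]; exact h
  · intro X n
    constructor
    · intro h
      exact ⟨n + 1, by beta_reduce at h ⊢; rw [seg_get X (n+1) n (by omega), h]⟩
    · rintro ⟨k, hk⟩
      have : n < k := by
        by_contra hh
        rw [List.getElem?_eq_none (by rw [seg_length]; omega)] at hk; simp at hk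
      rw [seg_get X k n this] at hk
      simpa using hk

theorem EO.mem {g : α → ℕ} (hg : Primrec g) : EO (fun X a => g a ∈ X) :=
  ((EO.mem' true).comp hg).congr (by simp)

theorem EO.nmem {g : α → ℕ} (hg : Primrec g) : EO (fun X a => g a ∉ X) :=
  ((EO.mem' false).comp hg).congr (by simp)

/-- Substitution of a uniformly Δ1 set for the oracle. -/
theorem EO.subst {P : Set ℕ → α → Prop} (hP : EO P) {D : Set ℕ → α → ℕ → Prop}
    (hD : EO (fun X (p : α × ℕ) => D X p.1 p.2)) (hD' : EO (fun X (p : α × ℕ) => ¬ D X p.1 p.2)) :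
    EO (fun X a => P {x | D X a x} a) := by
  obtain ⟨R, h1, h2, h3⟩ := hP
  have key : EO (fun X a => ∃ σ : List Bool, R σ a ∧ ∀ i < σ.length,
      ((σ[i]? = some true ∧ D X a i) ∨ (σ[i]? = some false ∧ ¬ D X a i))) := by
    apply EO.ex
    apply EO.and
    · exact EO.prim (h1.comp Primrec.snd Primrec.fst)
    · apply EO.all_lt _ (Primrec.list_length.comp Primrec.snd)
      have hg : ∀ v : Bool, PrimrecPred (fun p : (α × List Bool) × ℕ => p.1.2[p.2]? = some v) := fun v =>
        Primrec.eq.comp (Primrec.list_getElem?.comp (Primrec.snd.comp Primrec.fst) Primrec.snd) (Primrec.const _)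
      have hp : Primrec (fun p : (α × List Bool) × ℕ => (p.1.1, p.2)) :=
        Primrec.pair (Primrec.fst.comp Primrec.fst) Primrec.snd
      exact ((EO.prim (hg true)).and (hD.comp hp)).or ((EO.prim (hg false)).and (hD'.comp hp))
  refine key.congr ?_
  intro X a
  rw [h3]
  constructor
  · rintro ⟨k, hk⟩
    refine ⟨_, hk, ?_⟩
    intro i hi
    rw [seg_length] at hi
    rw [seg_get _ _ _ hi]
    by_cases h : D X a i <;> simp [h]
  · rintro ⟨σ, hσ, h⟩
    refine ⟨σ.length, ?_⟩
    have : seg {x | D X a x} σ.length = σ := by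
      apply List.ext_getElem?
      intro i
      by_cases hi : i < σ.length
      · rw [seg_get _ _ _ hi]
        rcases h i hi with ⟨h, h'⟩ | ⟨h, h'⟩ <;> simp [h, h']
      · rw [List.getElem?_eq_none (by rw [seg_length]; omega), List.getElem?_eq_none (by omega)]
    rwa [this]

end EOsec

end

section

theorem cantor_compact (U : ℕ → Set ℕ → Prop) (mono : ∀ i Y, U i Y → U (i + 1) Y)
    (hopen : ∀ i Y, U i Y → ∃ k, ∀ Y' : Set ℕ, (∀ j < k, (j ∈ Y ↔ j ∈ Y')) → U i Y')
    (h : ∀ Y, ∃ i, U i Y) : ∃ i, ∀ Y, U i Y := by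
  let V : ℕ → Set (ℕ → Bool) := fun i => {f | U i {n | f n = true}}
  have hV : ∀ i, IsOpen (V i) := by
    intro i
    rw [isOpen_iff_forall_mem_open]
    intro f hf
    obtain ⟨k, hk⟩ := hopen i _ hf
    refine ⟨Set.pi (Finset.range k : Set ℕ) (fun j => {f j}), ?_, ?_, ?_⟩
    · intro g hg
      apply hk
      intro j hj
      have := hg j (by simpa using hj)
      simp at this
      simp [this]
    · exact isOpen_set_pi (Finset.finite_toSet _) (fun j _ => isOpen_discrete _)
    · intro j _; simp
  have hm : Monotone V := by
    apply monotone_nat_of_le_succ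
    intro i f hf
    exact mono i _ hf
  obtain ⟨i, hi⟩ := isCompact_univ.elim_directed_cover V hV (by
    intro f _
    obtain ⟨i, hi⟩ := h {n | f n = true}
    exact Set.mem_iUnion.2 ⟨i, hi⟩) hm.directed_le
  refine ⟨i, fun Y => ?_⟩
  have := hi (Set.mem_univ (fun n => decide (n ∈ Y)))
  simpa [V] using this

def allStr : ℕ → List (List Bool)
  | 0 => [[]]
  | k + 1 => (allStr k).flatMap fun s => [s ++ [false], s ++ [true]]

theorem allStr_length (k : ℕ) : ∀ σ ∈ allStr k, σ.length = k := by
  induction k with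
  | zero => simp [allStr]
  | succ k ih =>
    intro σ hσ
    simp only [allStr, List.mem_flatMap] at hσ
    obtain ⟨s, hs, h⟩ := hσ
    have := ih s hs
    simp at h
    rcases h with rfl | rfl <;> simp [this]

theorem seg_succ (X : Set ℕ) (k : ℕ) : seg X (k + 1) = seg X k ++ [decide (k ∈ X)] := by
  simp [seg, List.range_succ]

theorem seg_mem_allStr (X : Set ℕ) (k : ℕ) : seg X k ∈ allStr k := by
  induction k with
  | zero => simp [allStr, seg]
  | succ k ih =>
    rw [seg_succ]
    simp only [allStr, List.mem_flatMap]
    refine ⟨_, ih, ?_⟩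
    by_cases h : k ∈ X <;> simp [h]

theorem primrec_allStr : Primrec allStr := by
  have : Primrec (fun k : ℕ => (Nat.rec [[]] (fun _ L => L.flatMap fun s => [s ++ [false], s ++ [true]]) k : List (List Bool))) := by
    refine Primrec.nat_rec₁ _ ?_
    refine Primrec.list_flatMap Primrec.snd ?_
    refine Primrec.list_cons.comp (Primrec.list_concat.comp Primrec.snd (Primrec.const _)) ?_
    exact Primrec.list_cons.comp (Primrec.list_concat.comp Primrec.snd (Primrec.const _)) (Primrec.const _)
  refine this.of_eq ?_
  intro k
  induction k with
  | zero => rfl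
  | succ k ih => simp only [allStr]; rw [← ih]

theorem join_even (X Y : Set ℕ) (i : ℕ) : 2 * i ∈ join X Y ↔ i ∈ X := by
  simp only [join, Set.mem_ofPred_eq]
  constructor
  · rintro (⟨a, h, h'⟩ | ⟨a, h, h'⟩)
    · rwa [show i = a by omega]
    · omega
  · intro h; exact Or.inl ⟨i, h, rfl⟩

theorem join_odd (X Y : Set ℕ) (i : ℕ) : 2 * i + 1 ∈ join X Y ↔ i ∈ Y := by
  simp only [join, Set.mem_ofPred_eq]
  constructor
  · rintro (⟨a, h, h'⟩ | ⟨a, h, h'⟩)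
    · omega
    · rwa [show i = a by omega]
  · intro h; exact Or.inr ⟨i, h, rfl⟩

theorem join_ext {X Y W : Set ℕ} (h0 : ∀ i, 2 * i ∈ W ↔ i ∈ X) (h1 : ∀ i, 2 * i + 1 ∈ W ↔ i ∈ Y) :
    W = join X Y := by
  ext n
  rcases Nat.even_or_odd' n with ⟨c, rfl | rfl⟩
  · rw [h0, join_even]
  · rw [h1, join_odd]

section
variable {α : Type} [Primcodable α]

theorem EO.allSet {P : Set ℕ → α → Prop} (hP : EO P) : EO (fun X a => ∀ Y, P (join X Y) a) := by
  have hP0 := hP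
  obtain ⟨R, h1, h2, h3⟩ := hP
  have key : EO (fun X a => ∃ k : ℕ, ∀ τ ∈ allStr k, ∃ σ : List Bool, R σ a ∧ ∀ i < σ.length,
      ((i % 2 = 0 ∧ ((σ[i]? = some true ∧ i / 2 ∈ X) ∨ (σ[i]? = some false ∧ i / 2 ∉ X))) ∨
        (i % 2 = 1 ∧ τ[i/2]? = σ[i]?))) := by
    apply EO.ex
    refine EO.all_mem (P := fun X (p : α × ℕ) (τ : List Bool) => ∃ σ : List Bool, R σ p.1 ∧ ∀ i < σ.length,
      ((i % 2 = 0 ∧ ((σ[i]? = some true ∧ i / 2 ∈ X) ∨ (σ[i]? = some false ∧ i / 2 ∉ X))) ∨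
        (i % 2 = 1 ∧ τ[i/2]? = σ[i]?))) (g := fun p : α × ℕ => allStr p.2) ?_ (primrec_allStr.comp Primrec.snd)
    apply EO.ex
    apply EO.and
    · exact EO.prim (h1.comp Primrec.snd (Primrec.fst.comp (Primrec.fst.comp Primrec.fst)))
    · apply EO.all_lt _ (Primrec.list_length.comp Primrec.snd)
      have hσ : Primrec (fun p : ((((α × ℕ) × List Bool) × List Bool) × ℕ) => p.1.2[p.2]?) :=
        Primrec.list_getElem?.comp (Primrec.snd.comp Primrec.fst) Primrec.snd
      have hd : Primrec (fun p : ((((α × ℕ) × List Bool) × List Bool) × ℕ) => p.2 / 2) :=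
        Primrec.nat_div.comp Primrec.snd (Primrec.const 2)
      have hm : Primrec (fun p : ((((α × ℕ) × List Bool) × List Bool) × ℕ) => p.2 % 2) :=
        Primrec.nat_mod.comp Primrec.snd (Primrec.const 2)
      have hτ : Primrec (fun p : ((((α × ℕ) × List Bool) × List Bool) × ℕ) => p.1.1.2[p.2 / 2]?) :=
        Primrec.list_getElem?.comp (Primrec.snd.comp (Primrec.fst.comp Primrec.fst)) hd
      refine EO.or (EO.and (EO.prim (Primrec.eq.comp hm (Primrec.const 0))) (EO.or (EO.and ?_ ?_) (EO.and ?_ ?_)))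
        (EO.and (EO.prim (Primrec.eq.comp hm (Primrec.const 1))) (EO.prim (Primrec.eq.comp hτ hσ)))
      · exact EO.prim (Primrec.eq.comp hσ (Primrec.const _))
      · exact EO.mem hd
      · exact EO.prim (Primrec.eq.comp hσ (Primrec.const _))
      · exact EO.nmem hd
  refine key.congr ?_
  intro X a
  constructor
  · intro h
    obtain ⟨k, hk⟩ := cantor_compact (fun k Y => R (seg (join X Y) k) a)
      (fun i Y hY => h2 _ _ _ (seg_prefix _ (Nat.le_succ i)) hY)
      (fun i Y hY => ⟨i, fun Y' hY' => by
        have : seg (join X Y) i = seg (join X Y') i := by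
          apply seg_congr
          intro j hj
          rcases Nat.even_or_odd' j with ⟨c, rfl | rfl⟩
          · rw [join_even, join_even]
          · rw [join_odd, join_odd]; exact hY' c (by omega)
        rwa [← this]⟩)
      (fun Y => (h3 _ _).1 (h Y))
    refine ⟨k, fun τ hτ => ⟨_, hk {i | τ[i]? = some true}, ?_⟩⟩
    intro i hi
    rw [seg_length] at hi
    rw [seg_get _ _ _ hi]
    have hl := allStr_length k τ hτ
    rcases Nat.even_or_odd' i with ⟨c, rfl | rfl⟩
    · left
      refine ⟨by omega, ?_⟩
      rw [show 2 * c / 2 = c by omega]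
      simp only [join_even]
      by_cases h : c ∈ X <;> simp [h]
    · right
      refine ⟨by omega, ?_⟩
      rw [show (2 * c + 1) / 2 = c by omega]
      simp only [join_odd]
      have : c < τ.length := by omega
      simp [List.getElem?_eq_getElem this]
  · rintro ⟨k, hk⟩ Y
    obtain ⟨σ, hσ, h⟩ := hk (seg Y k) (seg_mem_allStr Y k)
    rw [h3]
    refine ⟨σ.length, ?_⟩
    have : seg (join X Y) σ.length = σ := by
      apply List.ext_getElem?
      intro i
      by_cases hi : i < σ.length
      · rw [seg_get _ _ _ hi]
        rcases h i hi with ⟨hi2, h⟩ | ⟨hi2, h⟩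
        · obtain ⟨c, rfl⟩ : ∃ c, i = 2 * c := ⟨i / 2, by omega⟩
          rw [show 2 * c / 2 = c by omega] at h
          simp only [join_even]
          rcases h with ⟨h, h'⟩ | ⟨h, h'⟩ <;> simp [h, h']
        · obtain ⟨c, rfl⟩ : ∃ c, i = 2 * c + 1 := ⟨i / 2, by omega⟩
          rw [show (2 * c + 1) / 2 = c by omega] at h
          simp only [join_odd]
          have hc : c < k := by
            by_contra hh
            rw [List.getElem?_eq_none (by rw [seg_length]; omega), List.getElem?_eq_getElem hi] at h
            simp at h
          rw [seg_get _ _ _ hc] at h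
          exact h
      · rw [List.getElem?_eq_none (by rw [seg_length]; omega), List.getElem?_eq_none (by omega)]
    rwa [this]
end

def Dec (P : Set ℕ → ℕ × Bool → Prop) (X C : Set ℕ) : Prop :=
  ∀ n b, P X (n, b) ↔ b = decide (n ∈ C)

def Comp (X C : Set ℕ) : Prop := ∃ P : Set ℕ → ℕ × Bool → Prop, EO P ∧ Dec P X C

theorem Comp.subst {D : Set ℕ → ℕ → Prop} (hD : EO D) (hD' : EO (fun X n => ¬ D X n)) {Z C : Set ℕ}
    (h : Comp {x | D Z x} C) : Comp Z C := by
  obtain ⟨P, hP, h⟩ := h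
  exact ⟨fun X a => P {x | D X x} a,
    hP.subst (D := fun X _ x => D X x) (hD.comp Primrec.snd) (hD'.comp Primrec.snd), h⟩

theorem Comp.of {D : Set ℕ → ℕ → Prop} (hD : EO D) (hD' : EO (fun X n => ¬ D X n)) {Z : Set ℕ} :
    Comp Z {x | D Z x} := by
  refine ⟨fun X p => (p.2 = true ∧ D X p.1) ∨ (p.2 = false ∧ ¬ D X p.1), ?_, ?_⟩
  · exact (EO.and (EO.prim (Primrec.eq.comp Primrec.snd (Primrec.const _))) (hD.comp Primrec.fst)).or
      (EO.and (EO.prim (Primrec.eq.comp Primrec.snd (Primrec.const _))) (hD'.comp Primrec.fst))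
  · intro n b
    by_cases h : D Z n <;> cases b <;> simp [h]

theorem diag {Z C : Set ℕ} (h : ¬ Comp Z C) {P : Set ℕ → ℕ × Bool → Prop} (hP : EO P) :
    ∃ n b, (P Z (n, b) ∧ b ≠ decide (n ∈ C)) ∨ (¬ P Z (n, b) ∧ b = decide (n ∈ C)) := by
  by_contra hh
  push Not at hh
  refine h ⟨P, hP, fun n b => ⟨fun h1 => ?_, fun h1 => ?_⟩⟩
  · exact (hh n b).1 h1
  · by_contra h2
    exact (hh n b).2 h2 h1

theorem countable_primrec {γ : Type} [Primcodable γ] : {f : γ → Bool | Primrec f}.Countable := by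
  have h : ∀ f : {f : γ → Bool | Primrec f}, ∃ c : Nat.Partrec.Code, c.eval =
      (fun n => Part.some (Encodable.encode ((Encodable.decode (α := γ) n).map f.1))) := by
    intro f
    apply Nat.Partrec.Code.exists_code.1
    exact Nat.Partrec.of_primrec f.2
  choose c hc using h
  have inj : Function.Injective c := by
    intro f g hfg
    have := (hc f).symm.trans ((congrArg _ hfg).trans (hc g))
    apply Subtype.ext
    funext x
    have := congrFun this (Encodable.encode x)
    simpa using this
  exact Set.countable_coe_iff.1 inj.countable

theorem countable_EO {α : Type} [Primcodable α] : {P : Set ℕ → α → Prop | EO P}.Countable := by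
  refine ((countable_primrec (γ := List Bool × α)).image
    (fun f => fun X a => ∃ k, f (seg X k, a) = true)).mono ?_
  rintro P ⟨R, h1, h2, h3⟩
  refine ⟨fun p => decide (R p.1 p.2), h1.decide, ?_⟩
  funext X a
  simp [h3]

theorem enum_EO : ∃ E : ℕ → Set ℕ → ℕ × Bool → Prop, (∀ i, EO (E i)) ∧ ∀ P, EO P → ∃ i, E i = P := by
  obtain ⟨E, hE⟩ := (countable_EO (α := ℕ × Bool)).exists_eq_range
    ⟨fun _ p => p.2 = true, EO.prim (Primrec.eq.comp Primrec.snd (Primrec.const _))⟩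
  refine ⟨E, fun i => ?_, fun P hP => ?_⟩
  · have : E i ∈ {P : Set ℕ → ℕ × Bool → Prop | EO P} := hE ▸ Set.mem_range_self i
    exact this
  · have : P ∈ {P : Set ℕ → ℕ × Bool → Prop | EO P} := hP
    rw [hE] at this
    exact this

end

section

theorem dep_seq {T : Type} (r : ℕ → T → T → Prop) (h : ∀ n x, ∃ y, r n x y) (x0 : T) :
    ∃ s : ℕ → T, s 0 = x0 ∧ ∀ n, r n (s n) (s (n + 1)) := by
  choose f hf using h
  exact ⟨fun n => Nat.rec x0 (fun n x => f n x) n, rfl, fun n => hf n _⟩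

theorem join_agree {X Y Y' : Set ℕ} {k : ℕ} (h : ∀ j < k, (j ∈ Y ↔ j ∈ Y')) :
    ∀ j < k, (j ∈ join X Y ↔ j ∈ join X Y') := by
  intro j hj
  rcases Nat.even_or_odd' j with ⟨c, rfl | rfl⟩
  · rw [join_even, join_even]
  · rw [join_odd, join_odd]; exact h c (by omega)

theorem basis {Z C : Set ℕ} (h : ¬ Comp Z C) {U : Set ℕ → Unit → Prop} (hU : EO U)
    (hne : ∃ Y, ¬ U (join Z Y) ()) : ∃ Y, ¬ U (join Z Y) () ∧ ¬ Comp (join Z Y) C := by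
  obtain ⟨E, hE, hE'⟩ := enum_EO
  let T := {U : Set ℕ → Unit → Prop // EO U ∧ ∃ Y, ¬ U (join Z Y) ()}
  obtain ⟨s, hs0, hs⟩ := dep_seq (T := T)
    (fun i U V => (∀ Y, U.1 (join Z Y) () → V.1 (join Z Y) ()) ∧
      ∀ Y, ¬ V.1 (join Z Y) () → ¬ Dec (E i) (join Z Y) C) (by
    rintro i ⟨U, hU, hne⟩
    have hS : EO (fun X (p : ℕ × Bool) => ∀ Y, U (join X Y) () ∨ E i (join X Y) p) :=
      EO.allSet (P := fun W p => U W () ∨ E i W p) ((hU.comp (Primrec.const ())).or (hE i))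
    obtain ⟨n, b, ⟨h1, h2⟩ | ⟨h1, h2⟩⟩ := diag h hS
    · refine ⟨⟨U, hU, hne⟩, fun Y h => h, fun Y hY hd => ?_⟩
      rcases h1 Y with h1 | h1
      · exact hY h1
      · exact h2 ((hd n b).1 h1)
    · refine ⟨⟨fun W a => U W a ∨ E i W (n, b), hU.or ((hE i).comp (Primrec.const (n, b))), ?_⟩,
        fun Y h => Or.inl h, fun Y hY hd => ?_⟩
      · push Not at h1
        obtain ⟨Y, hY1, hY2⟩ := h1
        exact ⟨Y, by simp [hY1, hY2]⟩
      · exact hY (Or.inr ((hd n b).2 h2))) ⟨U, hU, hne⟩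
  have : ∃ Y, ∀ i, ¬ (s i).1 (join Z Y) () := by
    by_contra hcon
    push Not at hcon
    obtain ⟨i, hi⟩ := cantor_compact (fun i Y => (s i).1 (join Z Y) ()) (fun i Y hY => (hs i).1 Y hY)
      (fun i Y hY => by
        obtain ⟨k, hk⟩ := (s i).2.1.use hY
        exact ⟨k, fun Y' hY' => hk _ (join_agree hY')⟩) hcon
    obtain ⟨Y, hY⟩ := (s i).2.2
    exact hY (hi Y)
  obtain ⟨Y, hY⟩ := this
  refine ⟨Y, ?_, ?_⟩
  · have := hY 0
    rwa [hs0] at this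
  · rintro ⟨P, hP, hd⟩
    obtain ⟨i, rfl⟩ := hE' P hP
    exact (hs i).2 Y (hY (i + 1)) hd

theorem side_pos {Z C X : Set ℕ} {P : Set ℕ → ℕ × Bool → Prop} (hP : EO P) {F E : List ℕ} {n : ℕ} {b : Bool}
    (h : P (join Z {x | x ∈ F ∨ x ∈ E}) (n, b)) (hb : b ≠ decide (n ∈ C)) :
    ∃ k, ∀ G : Set ℕ, (∀ x ∈ F ++ E, x ∈ G) → (∀ x ∈ G, x ∈ F ++ E ∨ (x ∈ X ∧ k ≤ x)) →
      ¬ Dec P (join Z G) C := by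
  obtain ⟨k, hk⟩ := hP.use h
  refine ⟨k, fun G h1 h2 hd => hb ((hd n b).1 (hk _ (join_agree ?_)))⟩
  intro j hj
  constructor
  · intro h; exact h1 j (by simpa using h)
  · intro h
    rcases h2 j h with h | ⟨_, h⟩
    · simpa using h
    · omega

theorem side_neg {Z C X : Set ℕ} {P : Set ℕ → ℕ × Bool → Prop} (hP : EO P) {F : List ℕ} {n : ℕ} {b : Bool}
    (h : ∀ E : List ℕ, (∀ x ∈ E, x ∈ X) → ¬ P (join Z {x | x ∈ F ∨ x ∈ E}) (n, b))
    (hb : b = decide (n ∈ C)) :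
    ∀ G : Set ℕ, (∀ x ∈ F, x ∈ G) → (∀ x ∈ G, x ∈ F ∨ x ∈ X) → ¬ Dec P (join Z G) C := by
  intro G h1 h2 hd
  obtain ⟨k, hk⟩ := hP.use ((hd n b).2 hb)
  refine h ((List.range k).filter (fun x => x ∈ G ∧ x ∈ X)) ?_ (hk _ (join_agree ?_))
  · intro x hx
    simp at hx
    exact hx.2.2
  · intro j hj
    constructor
    · intro hG
      rcases h2 j hG with h | h
      · exact Or.inl h
      · exact Or.inr (by simp [hj, hG, h])
    · rintro (h | h)
      · exact h1 j h
      · simp at h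
        exact h.2.1

theorem comp_tail {Z X C : Set ℕ} (k : ℕ) (h : ¬ Comp (join Z X) C) : ¬ Comp (join Z {x | x ∈ X ∧ k ≤ x}) C := by
  intro hc
  apply h
  have hm : ∀ v, PrimrecPred (fun n : ℕ => n % 2 = v) := fun v =>
    Primrec.eq.comp (Primrec.nat_mod.comp Primrec.id (Primrec.const 2)) (Primrec.const v)
  have hk : PrimrecPred (fun n : ℕ => k ≤ n / 2) :=
    Primrec.nat_le.comp (Primrec.const k) (Primrec.nat_div.comp Primrec.id (Primrec.const 2))
  refine Comp.subst (D := fun W y => y ∈ W ∧ (y % 2 = 0 ∨ k ≤ y / 2)) ?_ ?_ ?_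
  · exact (EO.mem Primrec.id).and (EO.prim ((hm 0).or hk))
  · exact ((EO.nmem Primrec.id).or (EO.prim ((hm 0).or hk).not)).congr (fun X a => by simp only [id]; tauto)
  · convert hc using 1
    apply join_ext
    · intro i
      simp [join_even]
      try tauto
    · intro i
      have : (2 * i + 1) % 2 = 1 := by omega
      have : (2 * i + 1) / 2 = i := by omega
      simp [join_odd, *]

theorem comp_inter {Z X Y C : Set ℕ} (v : Bool) (h : ¬ Comp (join (join Z X) Y) C) :
    ¬ Comp (join Z {x | x ∈ X ∧ decide (x ∈ Y) = v}) C := by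
  intro hc
  apply h
  have hm : ∀ v, PrimrecPred (fun n : ℕ => n % 2 = v) := fun v =>
    Primrec.eq.comp (Primrec.nat_mod.comp Primrec.id (Primrec.const 2)) (Primrec.const v)
  refine Comp.subst (D := fun W y => 2 * y ∈ W ∧ (y % 2 = 0 ∨ decide (y ∈ W) = v)) ?_ ?_ ?_
  · exact (EO.mem Primrec.nat_double).and ((EO.prim (hm 0)).or (EO.mem' v))
  · refine ((EO.nmem Primrec.nat_double).or ((EO.prim (hm 0).not).and (EO.mem' (!v)))).congr (fun X a => ?_)
    cases v <;> simp <;> tauto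
  · convert hc using 1
    apply join_ext
    · intro i
      simp [join_even]
      try tauto
    · intro i
      have : (2 * i + 1) % 2 = 1 := by omega
      have h2 := join_odd (join Z X) Y i
      simp [join_even, join_odd]

/-- the computable matrix used in the forcing question -/
theorem EO_side {P : Set ℕ → ℕ × Bool → Prop} (hP : EO P) (F : List ℕ) (v : Bool) :
    EO (fun W p => ∃ E : List ℕ, (∀ x ∈ E, 2 * (2 * x + 1) ∈ W ∧ decide (2 * x + 1 ∈ W) = v) ∧
      P {y | (y % 2 = 0 ∧ 2 * y ∈ W) ∨ (y % 2 = 1 ∧ (y / 2 ∈ F ∨ y / 2 ∈ E))} p) := by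
  apply EO.ex
  apply EO.and
  · refine EO.all_mem (P := fun W (p : (ℕ × Bool) × List ℕ) x => 2 * (2 * x + 1) ∈ W ∧ decide (2 * x + 1 ∈ W) = v)
      (g := fun p => p.2) (EO.and (EO.mem ?_) ((EO.mem' v).comp ?_)) Primrec.snd
    · exact Primrec.nat_double.comp (Primrec.nat_double_succ.comp Primrec.snd)
    · exact Primrec.nat_double_succ.comp Primrec.snd
  · have hm : ∀ v, PrimrecPred (fun q : ((ℕ × Bool) × List ℕ) × ℕ => q.2 % 2 = v) := fun v =>
      Primrec.eq.comp (Primrec.nat_mod.comp Primrec.snd (Primrec.const 2)) (Primrec.const v)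
    have hmem : PrimrecRel (fun (L : List ℕ) (x : ℕ) => ∃ a ∈ L, a = x) := Primrec.eq.exists_mem_list
    have hd : Primrec (fun q : ((ℕ × Bool) × List ℕ) × ℕ => q.2 / 2) :=
      Primrec.nat_div.comp Primrec.snd (Primrec.const 2)
    have hFE : PrimrecPred (fun q : ((ℕ × Bool) × List ℕ) × ℕ => q.2 / 2 ∈ F ∨ q.2 / 2 ∈ q.1.2) :=
      ((hmem.comp (Primrec.const F) hd).or (hmem.comp (Primrec.snd.comp Primrec.fst) hd)).of_eq (by simp)
    have h2 : Primrec (fun q : ((ℕ × Bool) × List ℕ) × ℕ => 2 * q.2) := Primrec.nat_double.comp Primrec.snd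
    refine EO.subst (P := fun X (q : (ℕ × Bool) × List ℕ) => P X q.1)
      (D := fun W (q : (ℕ × Bool) × List ℕ) y => (y % 2 = 0 ∧ 2 * y ∈ W) ∨ (y % 2 = 1 ∧ (y / 2 ∈ F ∨ y / 2 ∈ q.2)))
      (hP.comp Primrec.fst) ?_ ?_
    · exact ((EO.prim (hm 0)).and (EO.mem h2)).or (EO.prim ((hm 1).and hFE))
    · refine (((EO.prim (hm 0)).and (EO.nmem h2)).or (EO.prim ((hm 1).and hFE.not))).congr ?_
      intro W q
      rcases Nat.mod_two_eq_zero_or_one q.2 with h | h <;> simp [h]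

theorem side_set (Z X Y : Set ℕ) (F E : List ℕ) :
    {y | (y % 2 = 0 ∧ 2 * y ∈ join (join Z X) Y) ∨ (y % 2 = 1 ∧ (y / 2 ∈ F ∨ y / 2 ∈ E))} =
      join Z {x | x ∈ F ∨ x ∈ E} := by
  apply join_ext
  · intro i
    simp [join_even]
  · intro i
    have : (2 * i + 1) / 2 = i := by omega
    simp [this]

structure Cond where
  F : Bool → List ℕ
  X : Set ℕ

def Cond.Inv (Z C A : Set ℕ) (s : Cond) : Prop :=
  (∀ v, ∀ x ∈ s.F v, decide (x ∈ A) = v) ∧ s.X.Infinite ∧ ¬ Comp (join Z s.X) C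

def Cond.Ext (s t : Cond) : Prop :=
  (∀ v, ∀ x ∈ s.F v, x ∈ t.F v) ∧ (∀ v, ∀ x ∈ t.F v, x ∈ s.F v ∨ x ∈ s.X) ∧ t.X ⊆ s.X

def Cond.Forces (s : Cond) (Z C : Set ℕ) (v : Bool) (P : Set ℕ → ℕ × Bool → Prop) : Prop :=
  ∀ G : Set ℕ, (∀ x ∈ s.F v, x ∈ G) → (∀ x ∈ G, x ∈ s.F v ∨ x ∈ s.X) → ¬ Dec P (join Z G) C

theorem Cond.Ext.trans {s t u : Cond} (h : s.Ext t) (h' : t.Ext u) : s.Ext u := by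
  refine ⟨fun v x hx => h'.1 v x (h.1 v x hx), fun v x hx => ?_, h'.2.2.trans h.2.2⟩
  rcases h'.2.1 v x hx with h1 | h1
  · exact h.2.1 v x h1
  · exact Or.inr (h.2.2 h1)

theorem inf_tail {X : Set ℕ} (h : X.Infinite) (k : ℕ) : {x | x ∈ X ∧ k ≤ x}.Infinite := by
  intro hf
  apply h
  refine (hf.union (Set.finite_lt_nat k)).subset ?_
  intro x hx
  by_cases hk : k ≤ x
  · exact Or.inl ⟨hx, hk⟩
  · exact Or.inr (by simpa using hk)

theorem req_step {Z C A : Set ℕ} (s : Cond) (hs : s.Inv Z C A) (P : Bool → Set ℕ → ℕ × Bool → Prop)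
    (hP : ∀ v, EO (P v)) : ∃ t : Cond, t.Inv Z C A ∧ s.Ext t ∧ ∃ v, t.Forces Z C v (P v) := by
  obtain ⟨hF, hX, hC⟩ := hs
  have hU : EO (fun W p => ∃ v, ∃ E : List ℕ, (∀ x ∈ E, 2 * (2 * x + 1) ∈ W ∧ decide (2 * x + 1 ∈ W) = v) ∧
      P v {y | (y % 2 = 0 ∧ 2 * y ∈ W) ∨ (y % 2 = 1 ∧ (y / 2 ∈ s.F v ∨ y / 2 ∈ E))} p) :=
    ((EO_side (hP true) (s.F true) true).or (EO_side (hP false) (s.F false) false)).congr (by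
      intro W p; rw [Bool.exists_bool, or_comm])
  obtain ⟨n, b, ⟨h1, h2⟩ | ⟨h1, h2⟩⟩ := diag hC hU.allSet
  · obtain ⟨v, E, hE, hp⟩ := h1 A
    rw [side_set] at hp
    simp only [join_even, join_odd] at hE
    obtain ⟨k, hk⟩ := side_pos (X := s.X) (hP v) hp h2
    refine ⟨⟨fun w => if w = v then s.F v ++ E else s.F w, {x | x ∈ s.X ∧ k ≤ x}⟩, ⟨?_, inf_tail hX k, comp_tail k hC⟩,
      ⟨?_, ?_, fun x hx => hx.1⟩, v, ?_⟩
    · intro w x hx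
      dsimp only at hx
      split_ifs at hx with hw
      · subst hw
        rcases List.mem_append.1 hx with hx | hx
        · exact hF w x hx
        · exact (hE x hx).2
      · exact hF w x hx
    · intro w x hx
      dsimp only
      split_ifs with hw
      · subst hw; exact List.mem_append_left _ hx
      · exact hx
    · intro w x hx
      dsimp only at hx
      split_ifs at hx with hw
      · subst hw
        rcases List.mem_append.1 hx with hx | hx
        · exact Or.inl hx
        · exact Or.inr (hE x hx).1
      · exact Or.inl hx
    · intro G hG1 hG2
      simp only [if_true] at hG1 hG2
      exact hk G hG1 hG2
  · rw [not_forall] at h1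
    obtain ⟨Y, hY1, hY2⟩ := basis hC (U := fun W _ => _) (hU.comp (Primrec.const (n, b))) h1
    have hinf : ∃ v : Bool, {x | x ∈ s.X ∧ decide (x ∈ Y) = v}.Infinite := by
      by_contra hcon
      push Not at hcon
      apply hX
      refine ((hcon true).union (hcon false)).subset ?_
      intro x hx
      by_cases h : x ∈ Y
      · exact Or.inl ⟨hx, by simpa using h⟩
      · exact Or.inr ⟨hx, by simpa using h⟩
    obtain ⟨v, hv⟩ := hinf
    refine ⟨⟨s.F, {x | x ∈ s.X ∧ decide (x ∈ Y) = v}⟩, ⟨hF, hv, comp_inter v hY2⟩,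
      ⟨fun _ _ h => h, fun _ _ h => Or.inl h, fun x hx => hx.1⟩, v, ?_⟩
    refine side_neg (hP v) (n := n) (b := b) ?_ h2
    intro E hE hp
    apply hY1
    refine ⟨v, E, ?_, ?_⟩
    · simp only [join_even, join_odd]
      exact hE
    · rw [side_set]; exact hp

theorem sca {Z C : Set ℕ} (h : ¬ Comp Z C) (A : Set ℕ) :
    ∃ S : Set ℕ, S.Infinite ∧ (S ⊆ A ∨ S ⊆ Aᶜ) ∧ ¬ Comp (join Z S) C := by
  by_contra hcon
  push Not at hcon
  obtain ⟨E, hE, hE'⟩ := enum_EO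
  -- both halves of each reservoir are infinite
  have hhalf : ∀ (X : Set ℕ), X.Infinite → ¬ Comp (join Z X) C → ∀ v : Bool, ∀ m, ∃ x ∈ X, m ≤ x ∧ decide (x ∈ A) = v := by
    intro X hX hC v m
    by_contra hno
    push Not at hno
    refine comp_tail m hC (hcon {x | x ∈ X ∧ m ≤ x} (inf_tail hX m) ?_)
    cases v
    · left
      rintro x ⟨hx, hm⟩
      simpa using hno x hx hm
    · right
      rintro x ⟨hx, hm⟩
      simpa using hno x hx hm
  let T := {s : Cond // s.Inv Z C A}
  have h0 : (⟨fun _ => [], Set.univ⟩ : Cond).Inv Z C A := by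
    refine ⟨by simp, Set.infinite_univ, fun hc => h ?_⟩
    refine Comp.subst (D := fun W y => y % 2 = 1 ∨ y / 2 ∈ W) ?_ ?_ ?_
    · exact (EO.prim (Primrec.eq.comp (Primrec.nat_mod.comp Primrec.id (Primrec.const 2)) (Primrec.const 1))).or
        (EO.mem (Primrec.nat_div.comp Primrec.id (Primrec.const 2)))
    · exact ((EO.prim (Primrec.eq.comp (Primrec.nat_mod.comp Primrec.id (Primrec.const 2)) (Primrec.const 1)).not).and
        (EO.nmem (Primrec.nat_div.comp Primrec.id (Primrec.const 2)))).congr (by simp)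
    · convert hc using 1
      apply join_ext
      · intro i; simp
      · intro i
        have : (2 * i + 1) % 2 = 1 := by omega
        simp
  obtain ⟨s, -, hs⟩ := dep_seq (T := T)
    (fun i s t => s.1.Ext t.1 ∧ (∀ v, ∃ x ∈ t.1.F v, i ≤ x) ∧
      ∃ v : Bool, t.1.Forces Z C v (E (if v then i.unpair.1 else i.unpair.2))) (by
    rintro i ⟨s, hs⟩
    choose x hx1 hx2 hx3 using fun v => hhalf s.X hs.2.1 hs.2.2 v i
    have ht : (⟨fun v => x v :: s.F v, s.X⟩ : Cond).Inv Z C A := by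
      refine ⟨?_, hs.2⟩
      intro v y hy
      rcases List.mem_cons.1 hy with rfl | hy
      · exact hx3 v
      · exact hs.1 v y hy
    obtain ⟨u, hu1, hu2, hu3⟩ := req_step _ ht (fun v => E (if v then i.unpair.1 else i.unpair.2)) (fun v => hE _)
    refine ⟨⟨u, hu1⟩, Cond.Ext.trans (t := ⟨fun v => x v :: s.F v, s.X⟩) ⟨?_, ?_, subset_rfl⟩ hu2, ?_, hu3⟩
    · intro v y hy
      exact List.mem_cons_of_mem _ hy
    · intro v y hy
      rcases List.mem_cons.1 hy with rfl | hy
      · exact Or.inr (hx1 v)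
      · exact Or.inl hy
    · intro v
      exact ⟨x v, hu2.1 v _ List.mem_cons_self, hx2 v⟩) ⟨_, h0⟩
  have hext : ∀ i j, i ≤ j → (s i).1.Ext (s j).1 := by
    intro i j hij
    induction j, hij using Nat.le_induction with
    | base => exact ⟨fun _ _ h => h, fun _ _ h => Or.inl h, subset_rfl⟩
    | succ j _ ih => exact ih.trans (hs j).1
  let G : Bool → Set ℕ := fun v => {x | ∃ i, x ∈ (s i).1.F v}
  have hGsub : ∀ v, ∀ x ∈ G v, decide (x ∈ A) = v := by
    rintro v x ⟨i, hi⟩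
    exact (s i).2.1 v x hi
  have hGinf : ∀ v, (G v).Infinite := by
    intro v
    rw [Set.infinite_iff_exists_gt]
    intro m
    obtain ⟨x, hx, hm⟩ := (hs (m + 1)).2.1 v
    exact ⟨x, ⟨_, hx⟩, by omega⟩
  have hGC : ∀ v, Comp (join Z (G v)) C := by
    intro v
    apply hcon _ (hGinf v)
    cases v
    · right; intro x hx; simpa using hGsub _ x hx
    · left; intro x hx; simpa using hGsub _ x hx
  have : ∀ v, ∃ i, Dec (E i) (join Z (G v)) C := by
    intro v
    obtain ⟨P, hP, hd⟩ := hGC v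
    obtain ⟨i, rfl⟩ := hE' P hP
    exact ⟨i, hd⟩
  choose e he using this
  obtain ⟨-, -, v, hv⟩ := hs (Nat.pair (e true) (e false))
  refine hv (G v) (fun x hx => ⟨_, hx⟩) ?_ ?_
  · rintro x ⟨i, hi⟩
    rcases le_total i (Nat.pair (e true) (e false) + 1) with hle | hle
    · exact Or.inl ((hext _ _ hle).1 v x hi)
    · exact (hext _ _ hle).2.1 v x hi
  · cases v <;> simpa using he _

end

section

theorem recin_EO {X : Set ℕ} {f : ℕ →. ℕ} (h : RecIn (chi X) f) :
    ∃ P : Set ℕ → ℕ × ℕ → Prop, EO P ∧ ∀ n v, v ∈ f n ↔ P X (n, v) := by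
  have hfun : ∀ {g : ℕ → ℕ}, Primrec g → ∃ P : Set ℕ → ℕ × ℕ → Prop, EO P ∧
      ∀ n v, v ∈ Part.some (g n) ↔ P X (n, v) := fun {g} hg =>
    ⟨fun _ p => p.2 = g p.1, EO.prim (Primrec.eq.comp Primrec.snd (hg.comp Primrec.fst)), by simp⟩
  induction h with
  | oracle =>
    refine ⟨fun X p => (p.1 ∈ X ∧ p.2 = 1) ∨ (p.1 ∉ X ∧ p.2 = 0), ?_, ?_⟩
    · exact ((EO.mem Primrec.fst).and (EO.prim (Primrec.eq.comp Primrec.snd (Primrec.const _)))).or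
        ((EO.nmem Primrec.fst).and (EO.prim (Primrec.eq.comp Primrec.snd (Primrec.const _))))
    · intro n v
      by_cases h : n ∈ X <;> simp [chi, h]
  | zero => exact hfun (g := fun _ => 0) (Primrec.const 0)
  | succ => exact hfun Primrec.succ
  | left => exact hfun (Primrec.fst.comp Primrec.unpair)
  | right => exact hfun (Primrec.snd.comp Primrec.unpair)
  | pair _ _ ihf ihg =>
    obtain ⟨P, hP, hP'⟩ := ihf
    obtain ⟨Q, hQ, hQ'⟩ := ihg
    refine ⟨fun X p => ∃ ab : ℕ × ℕ, (P X (p.1, ab.1) ∧ Q X (p.1, ab.2)) ∧ p.2 = Nat.pair ab.1 ab.2, ?_, ?_⟩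
    · apply EO.ex
      refine EO.and (EO.and (hP.comp ?_) (hQ.comp ?_)) (EO.prim (Primrec.eq.comp (Primrec.snd.comp Primrec.fst)
        (Primrec₂.natPair.comp (Primrec.fst.comp Primrec.snd) (Primrec.snd.comp Primrec.snd))))
      · exact Primrec.pair (Primrec.fst.comp Primrec.fst) (Primrec.fst.comp Primrec.snd)
      · exact Primrec.pair (Primrec.fst.comp Primrec.fst) (Primrec.snd.comp Primrec.snd)
    · intro n v
      simp only [Seq.seq, Part.mem_bind_iff, Part.map_eq_map, Part.mem_map_iff, ← hP', ← hQ', Prod.exists]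
      constructor
      · rintro ⟨_, ⟨a, ha, rfl⟩, b, hb, rfl⟩
        exact ⟨a, b, ⟨ha, hb⟩, rfl⟩
      · rintro ⟨a, b, ⟨ha, hb⟩, rfl⟩
        exact ⟨_, ⟨a, ha, rfl⟩, b, hb, rfl⟩
  | comp _ _ ihf ihg =>
    obtain ⟨P, hP, hP'⟩ := ihf
    obtain ⟨Q, hQ, hQ'⟩ := ihg
    refine ⟨fun X p => ∃ a : ℕ, Q X (p.1, a) ∧ P X (a, p.2), ?_, ?_⟩
    · apply EO.ex
      refine EO.and (hQ.comp ?_) (hP.comp ?_)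
      · exact Primrec.pair (Primrec.fst.comp Primrec.fst) Primrec.snd
      · exact Primrec.pair Primrec.snd (Primrec.snd.comp Primrec.fst)
    · intro n v
      simp only [← hP', ← hQ']
      exact Part.mem_bind_iff
  | @prec f g _ _ ihf ihg =>
    obtain ⟨P, hP, hP'⟩ := ihf
    obtain ⟨Q, hQ, hQ'⟩ := ihg
    refine ⟨fun X p => ∃ L : List ℕ, (P X (p.1.unpair.1, L.getD 0 0) ∧
      ∀ i < p.1.unpair.2, Q X (Nat.pair p.1.unpair.1 (Nat.pair i (L.getD i 0)), L.getD (i + 1) 0)) ∧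
      p.2 = L.getD p.1.unpair.2 0, ?_, ?_⟩
    · have h1 : Primrec (fun q : (ℕ × ℕ) × List ℕ => q.1.1.unpair.1) :=
        Primrec.fst.comp (Primrec.unpair.comp (Primrec.fst.comp Primrec.fst))
      have h2 : Primrec (fun q : (ℕ × ℕ) × List ℕ => q.1.1.unpair.2) :=
        Primrec.snd.comp (Primrec.unpair.comp (Primrec.fst.comp Primrec.fst))
      apply EO.ex
      refine EO.and (EO.and (hP.comp ?_) (EO.all_lt ?_ h2)) (EO.prim (Primrec.eq.comp (Primrec.snd.comp Primrec.fst) ?_))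
      · exact Primrec.pair h1 ((Primrec.list_getD 0).comp Primrec.snd (Primrec.const 0))
      · refine hQ.comp (Primrec.pair (Primrec₂.natPair.comp (h1.comp Primrec.fst) (Primrec₂.natPair.comp Primrec.snd ?_)) ?_)
        · exact (Primrec.list_getD 0).comp (Primrec.snd.comp Primrec.fst) Primrec.snd
        · exact (Primrec.list_getD 0).comp (Primrec.snd.comp Primrec.fst) (Primrec.succ.comp Primrec.snd)
      · exact (Primrec.list_getD 0).comp Primrec.snd h2
    · intro n v
      obtain ⟨⟨a, m⟩, rfl⟩ := Nat.pairEquiv.surjective n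
      simp only [Nat.pairEquiv_apply, Function.uncurry_apply_pair, Nat.unpaired, Nat.unpair_pair, ← hP', ← hQ']
      induction m generalizing v with
      | zero =>
        constructor
        · intro h; exact ⟨[v], ⟨by simpa using h, by simp⟩, by simp⟩
        · rintro ⟨L, ⟨h, -⟩, rfl⟩; exact h
      | succ m ih =>
        simp only [Part.bind_eq_bind, Part.mem_bind_iff]
        constructor
        · rintro ⟨i, hi, hv⟩
          obtain ⟨L, ⟨h0, hL⟩, rfl⟩ := (ih i).1 hi
          let L' := (List.range (m + 2)).map (fun j => if j ≤ m then L.getD j 0 else v)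
          have hL' : ∀ j ≤ m, L'.getD j 0 = L.getD j 0 := by
            intro j hj
            have : j < m + 2 := by omega
            simp [L', List.getD, this, hj]
          have hL'' : L'.getD (m + 1) 0 = v := by simp [L', List.getD]
          refine ⟨L', ⟨by rw [hL' 0 (by omega)]; exact h0, ?_⟩, hL''.symm⟩
          intro j hj
          rw [hL' j (by omega)]
          rcases Nat.lt_succ_iff_lt_or_eq.1 hj with hj | rfl
          · rw [hL' (j + 1) (by omega)]; exact hL j hj
          · rw [hL'']; exact hv
        · rintro ⟨L, ⟨h0, hL⟩, rfl⟩
          exact ⟨L.getD m 0, (ih _).2 ⟨L, ⟨h0, fun i hi => hL i (by omega)⟩, rfl⟩, hL m (by omega)⟩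
  | rfind _ ihf =>
    obtain ⟨P, hP, hP'⟩ := ihf
    refine ⟨fun X p => P X (Nat.pair p.1 p.2, 0) ∧ ∀ i < p.2, ∃ w : ℕ, w ≠ 0 ∧ P X (Nat.pair p.1 i, w), ?_, ?_⟩
    · refine EO.and (hP.comp ?_) (EO.all_lt (P := fun X (p : ℕ × ℕ) i => ∃ w : ℕ, w ≠ 0 ∧ P X (Nat.pair p.1 i, w)) (EO.ex (EO.and (EO.prim ?_) (hP.comp ?_))) Primrec.snd)
      · exact Primrec.pair (Primrec₂.natPair.comp Primrec.fst Primrec.snd) (Primrec.const 0)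
      · exact (Primrec.eq.comp Primrec.snd (Primrec.const 0)).not
      · exact Primrec.pair (Primrec₂.natPair.comp (Primrec.fst.comp (Primrec.fst.comp Primrec.fst)) (Primrec.snd.comp Primrec.fst)) Primrec.snd
    · intro n v
      refine Nat.mem_rfind.trans ?_
      simp only [Part.map_eq_map, Part.mem_map_iff, ← hP']
      constructor
      · rintro ⟨⟨a, ha, ha'⟩, h⟩
        simp at ha'
        subst ha'
        refine ⟨ha, fun i hi => ?_⟩
        obtain ⟨w, hw, hw'⟩ := h hi
        exact ⟨w, by simpa using hw', hw⟩
      · rintro ⟨h0, h⟩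
        refine ⟨⟨0, h0, by simp⟩, fun {i} hi => ?_⟩
        obtain ⟨w, hw, hw'⟩ := h i hi
        exact ⟨w, hw', by simpa using hw⟩

theorem TRed.comp {C X : Set ℕ} (h : TRed C X) : Comp X C := by
  obtain ⟨P, hP, hP'⟩ := recin_EO h
  refine ⟨fun X p => P X (p.1, if p.2 = true then 1 else 0), hP.comp ?_, ?_⟩
  · refine Primrec.pair Primrec.fst (Primrec.ite (Primrec.eq.comp Primrec.snd (Primrec.const true)) (Primrec.const 1) (Primrec.const 0))
  · intro n b
    beta_reduce
    rw [← hP']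
    by_cases h : n ∈ C <;> cases b <;> simp [chi, h]

theorem recin_of_eq {O : ℕ → ℕ} {f g : ℕ →. ℕ} (h : RecIn O f) (hfg : ∀ n, g n = f n) : RecIn O g := by
  have : g = f := funext hfg
  rwa [this]

theorem recin_of_partrec {O : ℕ → ℕ} {f : ℕ →. ℕ} (h : Nat.Partrec f) : RecIn O f := by
  induction h with
  | zero => exact RecIn.zero
  | succ => exact RecIn.succ
  | left => exact RecIn.left
  | right => exact RecIn.right
  | pair _ _ h1 h2 => exact RecIn.pair h1 h2
  | comp _ _ h1 h2 => exact RecIn.comp h1 h2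
  | prec _ _ h1 h2 => exact RecIn.prec h1 h2
  | rfind _ h => exact RecIn.rfind h

theorem recin_prim {O : ℕ → ℕ} {f : ℕ → ℕ} (h : Primrec f) : RecIn O (fun n => Part.some (f n)) :=
  recin_of_partrec (Nat.Partrec.of_primrec (Primrec.nat_iff.1 h))

theorem recin_comp {O : ℕ → ℕ} {f : ℕ →. ℕ} {g : ℕ → ℕ} (hf : RecIn O f) (hg : RecIn O (fun n => Part.some (g n))) :
    RecIn O (fun n => f (g n)) := by
  have := RecIn.comp hf hg
  refine recin_of_eq this (fun n => ?_)
  exact (Part.bind_some _ _).symm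

theorem recin_pair {O : ℕ → ℕ} {f g : ℕ → ℕ} (hf : RecIn O (fun n => Part.some (f n))) (hg : RecIn O (fun n => Part.some (g n))) :
    RecIn O (fun n => Part.some (Nat.pair (f n) (g n))) := by
  have := RecIn.pair hf hg
  refine recin_of_eq this (fun n => ?_)
  simp [Seq.seq]

theorem recin_seg (X : Set ℕ) : RecIn (chi X) (fun k => Part.some (Encodable.encode (seg X k))) := by
  let h : ℕ × ℕ → ℕ := fun p => Encodable.encode (((Encodable.decode (α := List Bool) p.2).getD []) ++ [decide (p.1 = 1)])
  have hh : Primrec h := by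
    refine Primrec.encode.comp (Primrec.list_concat.comp
      (Primrec.option_getD.comp (Primrec.decode.comp Primrec.snd) (Primrec.const [])) ?_)
    exact (Primrec.eq.decide.comp Primrec.fst (Primrec.const 1))
  have h1 : RecIn (chi X) (fun z => Part.some (h (chi X z.unpair.2.unpair.1, z.unpair.2.unpair.2))) := by
    have ho : RecIn (chi X) (fun z => Part.some (chi X z.unpair.2.unpair.1)) :=
      recin_comp (f := fun n => Part.some (chi X n)) RecIn.oracle (recin_prim (Primrec.fst.comp (Primrec.unpair.comp (Primrec.snd.comp Primrec.unpair))))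
    have hr : RecIn (chi X) (fun z => Part.some z.unpair.2.unpair.2) :=
      recin_prim (Primrec.snd.comp (Primrec.unpair.comp (Primrec.snd.comp Primrec.unpair)))
    have := recin_comp (f := fun n => Part.some (h n.unpair)) (recin_prim (hh.comp Primrec.unpair)) (recin_pair ho hr)
    simpa using this
  have h2 := RecIn.prec (recin_prim (O := chi X) (Primrec.const (Encodable.encode ([] : List Bool)))) h1
  have h3 := recin_comp h2 (recin_prim (f := fun k : ℕ => Nat.pair 0 k) (Primrec₂.natPair.comp (Primrec.const 0) Primrec.id))
  refine recin_of_eq h3 (fun k => ?_)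
  simp only [Nat.unpaired, Nat.unpair_pair]
  induction k with
  | zero => simp [seg]
  | succ k ih =>
    dsimp only
    rw [← ih, seg_succ]
    by_cases hk : k ∈ X <;> simp [h, chi, hk]

theorem recin_segfun (X : Set ℕ) {g : List Bool × ℕ → ℕ} (hg : Primrec g) :
    RecIn (chi X) (fun m => Part.some (g (seg X m.unpair.2, m.unpair.1))) := by
  have h1 : Primrec (fun z : ℕ => g ((Encodable.decode (α := List Bool) z.unpair.1).getD [], z.unpair.2)) :=
    hg.comp (Primrec.pair (Primrec.option_getD.comp (Primrec.decode.comp (Primrec.fst.comp Primrec.unpair)) (Primrec.const []))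
      (Primrec.snd.comp Primrec.unpair))
  have hs := recin_comp (recin_seg X) (recin_prim (Primrec.snd.comp Primrec.unpair))
  have := recin_comp (recin_prim (O := chi X) h1) (recin_pair hs (recin_prim (Primrec.fst.comp Primrec.unpair)))
  simpa using this

theorem Comp.tred {C X : Set ℕ} (h : Comp X C) : TRed C X := by
  obtain ⟨P, ⟨R, h1, h2, h3⟩, hd⟩ := h
  have hR : ∀ v : Bool, PrimrecPred (fun p : List Bool × ℕ => R p.1 (p.2, v)) := fun v =>
    h1.comp Primrec.fst (Primrec.pair Primrec.snd (Primrec.const v))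
  let t : List Bool × ℕ → ℕ := fun p => if R p.1 (p.2, true) ∨ R p.1 (p.2, false) then 0 else 1
  have ht : Primrec t := Primrec.ite ((hR true).or (hR false)) (Primrec.const 0) (Primrec.const 1)
  let o : List Bool × ℕ → ℕ := fun p => if R p.1 (p.2, true) then 1 else 0
  have ho : Primrec o := Primrec.ite (hR true) (Primrec.const 1) (Primrec.const 0)
  have hr := RecIn.rfind (recin_segfun X ht)
  have hfin := RecIn.comp (recin_segfun X ho) (RecIn.pair (recin_prim (O := chi X) Primrec.id) hr)
  unfold TRed
  refine recin_of_eq hfin (fun n => ?_)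
  symm
  rw [Part.eq_some_iff]
  have hex : ∃ k, t (seg X k, n) = 0 := by
    have := (hd n (decide (n ∈ C))).2 rfl
    obtain ⟨k, hk⟩ := (h3 _ _).1 this
    refine ⟨k, if_pos ?_⟩
    by_cases hn : n ∈ C
    · left; simpa [hn] using hk
    · right; simpa [hn] using hk
  simp only [Part.bind_eq_bind, Part.mem_bind_iff, Seq.seq, Part.map_eq_map, Part.mem_map_iff, Nat.unpair_pair]
  refine ⟨Nat.pair n (Nat.find hex), ⟨Nat.pair n, ⟨n, by simp, rfl⟩, Nat.find hex, ?_, rfl⟩, ?_⟩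
  · refine Nat.mem_rfind.2 ⟨?_, fun {m} hm => ?_⟩
    · have := Nat.find_spec hex
      simp [this]
    · have := Nat.find_min hex hm
      simp [this]
  · have hk := Nat.find_spec hex
    rw [Nat.unpair_pair]
    simp only [Part.mem_some_iff]
    generalize Nat.find hex = k at hk
    have hc : ∀ v, R (seg X k) (n, v) → v = decide (n ∈ C) := fun v hv => (hd n v).1 ((h3 _ _).2 ⟨k, hv⟩)
    by_cases hn : n ∈ C
    · have : R (seg X k) (n, true) := by
        by_contra hno
        have : ¬ R (seg X k) (n, false) := fun hf => by simpa [hn] using hc _ hf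
        simp [t, *] at hk
      simp [chi, o, hn, this]
    · have : ¬ R (seg X k) (n, true) := fun hf => by simpa [hn] using hc _ hf
      simp [chi, o, hn, this]

end

section

theorem EO_ext {P : Set ℕ → ℕ × Bool → Prop} (hP : EO P) (m k : ℕ) :
    EO (fun V p => ∃ E : List ℕ, (∀ y ∈ E, m ≤ y ∧ k < y.unpair.1) ∧ P {y | y ∈ V ∨ y ∈ E} p) := by
  apply EO.ex
  refine EO.and (EO.all_mem (P := fun _ (_ : (ℕ × Bool) × List ℕ) y => m ≤ y ∧ k < y.unpair.1) ?_ Primrec.snd) ?_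
  · apply EO.prim
    exact PrimrecPred.and (Primrec.nat_le.comp (Primrec.const _) Primrec.snd)
      (Primrec.nat_lt.comp (Primrec.const _) (Primrec.fst.comp (Primrec.unpair.comp Primrec.snd)))
  · have hmem : PrimrecPred (fun q : ((ℕ × Bool) × List ℕ) × ℕ => q.2 ∈ q.1.2) := by
      have : PrimrecPred (fun q : ((ℕ × Bool) × List ℕ) × ℕ => ∃ x ∈ q.1.2, x = q.2) :=
        PrimrecRel.comp (R := fun (l : List ℕ) (n : ℕ) => ∃ x ∈ l, x = n) (PrimrecRel.exists_mem_list Primrec.eq) (Primrec.snd.comp Primrec.fst) Primrec.snd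
      exact this.of_eq (by simp)
    refine (hP.comp Primrec.fst).subst (D := fun X (q : (ℕ × Bool) × List ℕ) y => y ∈ X ∨ y ∈ q.2) ?_ ?_
    · exact (EO.mem Primrec.snd).or (EO.prim hmem)
    · exact ((EO.nmem Primrec.snd).and (EO.prim hmem.not)).congr (by simp)

theorem comp_next {V S C : Set ℕ} (E : List ℕ) (m k : ℕ) (h : ¬ Comp (join V S) C) :
    ¬ Comp {y | y ∈ V ∨ y ∈ E ∨ (y.unpair.1 = k ∧ y.unpair.2 ∈ S ∧ m ≤ y)} C := by
  intro hc
  apply h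
  have hmem : PrimrecPred (fun y : ℕ => y ∈ E) := by
    have : PrimrecPred (fun y : ℕ => ∃ x ∈ E, x = y) :=
      PrimrecRel.comp (R := fun (l : List ℕ) (n : ℕ) => ∃ x ∈ l, x = n) (PrimrecRel.exists_mem_list Primrec.eq) (Primrec.const E) Primrec.id
    exact this.of_eq (by simp)
  have hk : PrimrecPred (fun y : ℕ => y.unpair.1 = k) :=
    Primrec.eq.comp (Primrec.fst.comp Primrec.unpair) (Primrec.const _)
  have hm : PrimrecPred (fun y : ℕ => m ≤ y) := Primrec.nat_le.comp (Primrec.const _) Primrec.id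
  have g1 : Primrec (fun y : ℕ => 2 * y) := Primrec.nat_mul.comp (Primrec.const 2) Primrec.id
  have g2 : Primrec (fun y : ℕ => 2 * y.unpair.2 + 1) := 
    Primrec.succ.comp (Primrec.nat_mul.comp (Primrec.const 2) (Primrec.snd.comp Primrec.unpair))
  refine Comp.subst (D := fun W y => 2 * y ∈ W ∨ y ∈ E ∨ (y.unpair.1 = k ∧ 2 * y.unpair.2 + 1 ∈ W ∧ m ≤ y)) ?_ ?_ ?_
  · exact (EO.mem g1).or ((EO.prim hmem).or ((EO.prim hk).and ((EO.mem g2).and (EO.prim hm))))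
  · refine ((EO.nmem g1).and ((EO.prim hmem.not).and ((EO.prim hk.not).or ((EO.nmem g2).or (EO.prim hm.not))))).congr ?_
    intro X a
    tauto
  · simpa only [join_even, join_odd] using hc

structure St where
  V : Set ℕ
  m : ℕ

def St.Inv (s : St) (C : Set ℕ) (k : ℕ) : Prop :=
  ¬ Comp s.V C ∧ ∀ y ∈ s.V, k < y.unpair.1 → y < s.m

def St.Ext (s t : St) (k : ℕ) : Prop :=
  s.m ≤ t.m ∧ s.V ⊆ t.V ∧ ∀ y ∈ t.V, y ∈ s.V ∨ (s.m ≤ y ∧ k < y.unpair.1)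

theorem st_step {C : Set ℕ} {s : St} {k : ℕ} (hs : s.Inv C k) {P : Set ℕ → ℕ × Bool → Prop} (hP : EO P) (A : Set ℕ) :
    ∃ t : St, t.Inv C (k + 1) ∧ s.Ext t k ∧
      (∃ S : Set ℕ, S.Infinite ∧ (S ⊆ A ∨ S ⊆ Aᶜ) ∧
        ∀ x, t.m ≤ Nat.pair (k + 1) x → (Nat.pair (k + 1) x ∈ t.V ↔ x ∈ S)) ∧
      ∀ Y : Set ℕ, t.V ⊆ Y → (∀ y ∈ Y, y ∈ t.V ∨ (t.m ≤ y ∧ k + 1 < y.unpair.1)) → ¬ Dec P Y C := by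
  obtain ⟨hc, hV⟩ := hs
  have key : ∃ (E : List ℕ) (m' : ℕ), s.m ≤ m' ∧ (∀ y ∈ E, s.m ≤ y ∧ k < y.unpair.1 ∧ y < m') ∧
      ∀ Y : Set ℕ, (∀ y, y ∈ s.V ∨ y ∈ E → y ∈ Y) →
        (∀ y ∈ Y, y ∈ s.V ∨ y ∈ E ∨ (m' ≤ y ∧ k < y.unpair.1)) → ¬ Dec P Y C := by
    obtain ⟨n, b, ⟨⟨E, hE, h⟩, hb⟩ | ⟨h, hb⟩⟩ := diag hc (EO_ext hP s.m k)
    · obtain ⟨u, hu⟩ := hP.use h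
      have hsum : ∀ y ∈ E, y < E.sum + 1 := fun y hy => Nat.lt_succ_of_le (List.single_le_sum (by simp) y hy)
      refine ⟨E, s.m + u + (E.sum + 1), by omega, fun y hy => ⟨(hE y hy).1, (hE y hy).2, by have := hsum y hy; omega⟩, ?_⟩
      intro Y h1 h2 hD
      refine hb ((hD n b).1 (hu Y fun i hi => ⟨fun hh => h1 i hh, fun hh => ?_⟩))
      rcases h2 i hh with h3 | h3 | h3
      · exact Or.inl h3
      · exact Or.inr h3
      · omega
    · refine ⟨[], s.m, le_rfl, by simp, ?_⟩
      intro Y h1 h2 hD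
      obtain ⟨u, hu⟩ := hP.use ((hD n b).2 hb)
      apply h
      refine ⟨(List.range u).filter (fun y => decide (y ∈ Y ∧ y ∉ s.V)), ?_, hu _ fun i hi => ?_⟩
      · intro y hy
        simp only [List.mem_filter, decide_eq_true_eq] at hy
        rcases h2 y hy.2.1 with h3 | h3 | h3
        · exact absurd h3 hy.2.2
        · simp at h3
        · exact h3
      · have := h1 i
        simp only [Set.mem_ofPred_eq, List.mem_filter, List.mem_range, decide_eq_true_eq]
        by_cases hi' : i ∈ s.V
        · simp [hi', this (Or.inl hi')]
        · simp [hi', hi]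
  obtain ⟨E, m', hm, hE, hY⟩ := key
  obtain ⟨S, hS, hSA, hSC⟩ := sca hc A
  refine ⟨⟨{y | y ∈ s.V ∨ y ∈ E ∨ (y.unpair.1 = k + 1 ∧ y.unpair.2 ∈ S ∧ m' ≤ y)}, m'⟩,
    ⟨comp_next E m' (k + 1) hSC, ?_⟩, ⟨hm, fun y hy => Or.inl hy, ?_⟩, ⟨S, hS, hSA, ?_⟩, ?_⟩
  · rintro y (h | h | h) hk
    · exact lt_of_lt_of_le (hV y h (by omega)) hm
    · exact (hE y h).2.2
    · omega
  · rintro y (h | h | h)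
    · exact Or.inl h
    · exact Or.inr ⟨(hE y h).1, (hE y h).2.1⟩
    · exact Or.inr ⟨hm.trans h.2.2, by omega⟩
  · intro x hx
    dsimp only at hx ⊢
    simp only [Set.mem_ofPred_eq, Nat.unpair_pair]
    constructor
    · rintro (h | h | h)
      · have := hV _ h (by simp)
        omega
      · have := (hE _ h).2.2
        omega
      · exact h.2.1
    · exact fun h => Or.inr (Or.inr ⟨by simp, h, hx⟩)
  · intro Y h1 h2
    refine hY Y (fun y hy => h1 (by rcases hy with h | h <;> simp [h])) (fun y hy => ?_)
    rcases h2 y hy with (h | h | h) | h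
    · exact Or.inl h
    · exact Or.inr (Or.inl h)
    · exact Or.inr (Or.inr ⟨h.2.2, by omega⟩)
    · exact Or.inr (Or.inr ⟨h.1, by omega⟩)

theorem main_step {Z C : Set ℕ} (h : ¬ Comp Z C) (A : ℕ → Set ℕ) :
    ∃ Y, Comp Y Z ∧ ¬ Comp Y C ∧ ∀ k, ∃ S : Set ℕ, S.Infinite ∧ (S ⊆ A k ∨ S ⊆ (A k)ᶜ) ∧ Comp Y S := by
  obtain ⟨E, hE, hE'⟩ := enum_EO
  let V0 : Set ℕ := {y | y.unpair.1 = 0 ∧ y.unpair.2 ∈ Z}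
  have hV0 : ¬ Comp V0 C := by
    intro hc
    apply h
    have hk : PrimrecPred (fun y : ℕ => y.unpair.1 = 0) :=
      Primrec.eq.comp (Primrec.fst.comp Primrec.unpair) (Primrec.const _)
    have hg : Primrec (fun y : ℕ => y.unpair.2) := Primrec.snd.comp Primrec.unpair
    refine Comp.subst (D := fun W y => y.unpair.1 = 0 ∧ y.unpair.2 ∈ W) ((EO.prim hk).and (EO.mem hg)) ?_ hc
    refine ((EO.prim hk.not).or (EO.nmem hg)).congr ?_
    intro X a; tauto
  obtain ⟨s, hs0, hs⟩ := dep_seq (T := St) (fun k s t => s.Inv C k → t.Inv C (k + 1) ∧ s.Ext t k ∧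
      (∃ S : Set ℕ, S.Infinite ∧ (S ⊆ A k ∨ S ⊆ (A k)ᶜ) ∧
        ∀ x, t.m ≤ Nat.pair (k + 1) x → (Nat.pair (k + 1) x ∈ t.V ↔ x ∈ S)) ∧
      ∀ Y : Set ℕ, t.V ⊆ Y → (∀ y ∈ Y, y ∈ t.V ∨ (t.m ≤ y ∧ k + 1 < y.unpair.1)) → ¬ Dec (E k) Y C)
    (fun k s => by
      by_cases hi : s.Inv C k
      · obtain ⟨t, ht⟩ := st_step hi (hE k) (A k)
        exact ⟨t, fun _ => ht⟩
      · exact ⟨s, fun hh => absurd hh hi⟩) ⟨V0, 0⟩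
  have hinv : ∀ k, (s k).Inv C k := by
    intro k
    induction k with
    | zero =>
      rw [hs0]
      refine ⟨hV0, ?_⟩
      rintro y ⟨h1, h2⟩ h3
      omega
    | succ k ih => exact (hs k ih).1
  have hext : ∀ k d, (s k).Ext (s (k + d)) k := by
    intro k d
    induction d with
    | zero => exact ⟨le_rfl, subset_rfl, fun y hy => Or.inl hy⟩
    | succ d ih =>
      obtain ⟨a1, a2, a3⟩ := ih
      obtain ⟨b1, b2, b3⟩ := (hs (k + d) (hinv _)).2.1
      refine ⟨a1.trans b1, a2.trans b2, fun y hy => ?_⟩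
      rcases b3 y hy with h1 | h1
      · exact a3 y h1
      · exact Or.inr ⟨a1.trans h1.1, by omega⟩
  let Y : Set ℕ := {y | ∃ k, y ∈ (s k).V}
  have hsub : ∀ k, (s k).V ⊆ Y := fun k y hy => ⟨k, hy⟩
  have hnew : ∀ k, ∀ y ∈ Y, y ∈ (s k).V ∨ ((s k).m ≤ y ∧ k < y.unpair.1) := by
    rintro k y ⟨j, hj⟩
    rcases le_total j k with hjk | hjk
    · obtain ⟨d, rfl⟩ := Nat.exists_eq_add_of_le hjk
      exact Or.inl ((hext j d).2.1 hj)
    · obtain ⟨d, rfl⟩ := Nat.exists_eq_add_of_le hjk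
      exact (hext k d).2.2 y hj
  have hcol : ∀ k : ℕ, Primrec (fun x : ℕ => Nat.pair k x) := fun k =>
    Primrec₂.natPair.comp (Primrec.const k) Primrec.id
  refine ⟨Y, ?_, ?_, ?_⟩
  · have hZ : Z = {x | Nat.pair 0 x ∈ Y} := by
      ext x
      constructor
      · intro hx
        refine hsub 0 ?_
        rw [hs0]
        exact ⟨by simp, by simpa using hx⟩
      · intro hx
        rcases hnew 0 _ hx with h1 | h1
        · rw [hs0] at h1
          simpa using h1.2
        · simp at h1
    rw [hZ]
    exact Comp.of (D := fun W x => Nat.pair 0 x ∈ W) (Z := Y) (EO.mem (hcol 0)) (EO.nmem (hcol 0))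
  · rintro ⟨P, hP, hD⟩
    obtain ⟨k, rfl⟩ := hE' P hP
    exact (hs k (hinv k)).2.2.2 Y (hsub _) (hnew _) hD
  · intro k
    obtain ⟨S, hS, hSA, hS'⟩ := (hs k (hinv k)).2.2.1
    have heq : ∀ x, ((s (k + 1)).m ≤ Nat.pair (k + 1) x ∧ Nat.pair (k + 1) x ∈ Y) ↔
        (x ∈ S ∧ (s (k + 1)).m ≤ Nat.pair (k + 1) x) := by
      intro x
      constructor
      · rintro ⟨h1, h2⟩
        refine ⟨(hS' x h1).1 ?_, h1⟩
        rcases hnew (k + 1) _ h2 with h3 | h3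
        · exact h3
        · simp at h3
      · rintro ⟨h1, h2⟩
        exact ⟨h2, hsub (k + 1) ((hS' x h2).2 h1)⟩
    refine ⟨{x | (s (k + 1)).m ≤ Nat.pair (k + 1) x ∧ Nat.pair (k + 1) x ∈ Y}, ?_, ?_, ?_⟩
    · refine (inf_tail hS (s (k + 1)).m).mono ?_
      rintro x ⟨h1, h2⟩
      exact (heq x).2 ⟨h1, h2.trans (Nat.right_le_pair _ _)⟩
    · exact hSA.imp (fun hh x hx => hh ((heq x).1 hx).1) (fun hh x hx => hh ((heq x).1 hx).1)
    · have hm : PrimrecPred (fun x : ℕ => (s (k + 1)).m ≤ Nat.pair (k + 1) x) :=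
        Primrec.nat_le.comp (Primrec.const _) (hcol _)
      refine Comp.of (D := fun W x => (s (k + 1)).m ≤ Nat.pair (k + 1) x ∧ Nat.pair (k + 1) x ∈ W) (Z := Y)
        ((EO.prim hm).and (EO.mem (hcol _))) ?_
      refine ((EO.prim hm.not).or (EO.nmem (hcol (k + 1)))).congr ?_
      intro X a; tauto

end

theorem recin_code {O : ℕ → ℕ} {f : ℕ →. ℕ} (h : RecIn O f) : ∃ c, evalo O c = f := by
  induction h with
  | oracle => exact ⟨.oracle, rfl⟩
  | zero => exact ⟨.zero, rfl⟩
  | succ => exact ⟨.succ, rfl⟩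
  | left => exact ⟨.left, rfl⟩
  | right => exact ⟨.right, rfl⟩
  | pair _ _ h1 h2 =>
    obtain ⟨c, rfl⟩ := h1
    obtain ⟨d, rfl⟩ := h2
    exact ⟨.pair c d, rfl⟩
  | comp _ _ h1 h2 =>
    obtain ⟨c, rfl⟩ := h1
    obtain ⟨d, rfl⟩ := h2
    exact ⟨.comp c d, rfl⟩
  | prec _ _ h1 h2 =>
    obtain ⟨c, rfl⟩ := h1
    obtain ⟨d, rfl⟩ := h2
    exact ⟨.prec c d, rfl⟩
  | rfind _ h1 =>
    obtain ⟨c, rfl⟩ := h1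
    refine ⟨.comp (.rfind' c) (.pair (.pair .left .right) .zero), ?_⟩
    funext n
    simp [evalo, Seq.seq, Nat.unpaired]
    exact Part.map_id' (fun x => rfl) _

theorem ofNat_surj (c : OCode) : ∃ n, ofNatOCode n = c := by
  have key : ∀ (a b : Bool) (m : ℕ), ∃ n : ℕ, n.bodd = a ∧ n.div2.bodd = b ∧ n.div2.div2 = m := fun a b m =>
    ⟨Nat.bit a (Nat.bit b m), by simp⟩
  induction c with
  | zero => exact ⟨0, by rw [ofNatOCode]⟩
  | succ => exact ⟨1, by rw [ofNatOCode]⟩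
  | left => exact ⟨2, by rw [ofNatOCode]⟩
  | right => exact ⟨3, by rw [ofNatOCode]⟩
  | oracle => exact ⟨4, by rw [ofNatOCode]⟩
  | pair c d h1 h2 =>
    obtain ⟨i, rfl⟩ := h1
    obtain ⟨j, rfl⟩ := h2
    obtain ⟨n, ha, hb, hm⟩ := key false false (Nat.pair i j)
    exact ⟨n + 5, by rw [ofNatOCode]; simp [ha, hb, hm]⟩
  | comp c d h1 h2 =>
    obtain ⟨i, rfl⟩ := h1
    obtain ⟨j, rfl⟩ := h2
    obtain ⟨n, ha, hb, hm⟩ := key false true (Nat.pair i j)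
    exact ⟨n + 5, by rw [ofNatOCode]; simp [ha, hb, hm]⟩
  | prec c d h1 h2 =>
    obtain ⟨i, rfl⟩ := h1
    obtain ⟨j, rfl⟩ := h2
    obtain ⟨n, ha, hb, hm⟩ := key true false (Nat.pair i j)
    exact ⟨n + 5, by rw [ofNatOCode]; simp [ha, hb, hm]⟩
  | rfind' c h1 =>
    obtain ⟨i, rfl⟩ := h1
    obtain ⟨n, ha, hb, hm⟩ := key true true i
    exact ⟨n + 5, by rw [ofNatOCode]; simp [ha, hb, hm]⟩

theorem K_not_comp : ¬ TRed K ∅ := by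
  intro h
  have h1 : RecIn (chi ∅) (fun n => Part.some (chi K n.unpair.1)) :=
    recin_comp (f := fun n => Part.some (chi K n)) h RecIn.left
  obtain ⟨c, hc⟩ := recin_code (RecIn.rfind h1)
  obtain ⟨e, rfl⟩ := ofNat_surj c
  have h2 : e ∈ K ↔ (evalo (chi ∅) (ofNatOCode e) e).Dom := Iff.rfl
  rw [hc, Part.dom_iff_mem] at h2
  by_cases he : e ∈ K
  · obtain ⟨n, hn⟩ := h2.1 he
    have := (Nat.mem_rfind.1 hn).1
    simp [chi, he] at this
  · refine he (h2.2 ⟨0, Nat.mem_rfind.2 ⟨?_, fun {m} hm => absurd hm (Nat.not_lt_zero _)⟩⟩)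
    simp [chi, he]

/-- an increasing sequence `Y₀ ≤_T Y₁ ≤_T ⋯` with `∅' ≰_T Y_e` such that
every set `Δ⁰₂` relative to `Y_e` has an infinite subset or cosubset computable in
`Y_{e+1}` (so the ideal generated is an ω-model of SRAM omitting degree `0'`). -/
theorem stmt12 :
    ∃ Y : ℕ → Set ℕ,
      (∀ e, TRed (Y e) (Y (e + 1))) ∧
      (∀ e, ¬ TRed K (Y e)) ∧
      ∀ (e : ℕ) (A : Set ℕ), TRed A (jump (Y e)) →
        ∃ S : Set ℕ, S.Infinite ∧ (S ⊆ A ∨ S ⊆ Aᶜ) ∧ TRed S (Y (e + 1)) := by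
  obtain ⟨E, hE, hE'⟩ := enum_EO
  obtain ⟨Y, -, hY⟩ := dep_seq (T := {Z : Set ℕ // ¬ Comp Z K})
    (fun _ Z W => Comp W.1 Z.1 ∧ ∀ i, ∃ S : Set ℕ, S.Infinite ∧
      (S ⊆ {n | E i (jump Z.1) (n, true)} ∨ S ⊆ {n | E i (jump Z.1) (n, true)}ᶜ) ∧ Comp W.1 S)
    (fun _ Z => by
      obtain ⟨W, h1, h2, h3⟩ := main_step Z.2 (fun i => {n | E i (jump Z.1) (n, true)})
      exact ⟨⟨W, h2⟩, h1, h3⟩) ⟨∅, fun h => K_not_comp h.tred⟩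
  refine ⟨fun e => (Y e).1, fun e => (hY e).1.tred, fun e h => (Y e).2 h.comp, fun e A hA => ?_⟩
  obtain ⟨P, hP, hD⟩ := hA.comp
  obtain ⟨i, rfl⟩ := hE' P hP
  have hAeq : {n | E i (jump (Y e).1) (n, true)} = A := by
    ext n
    have := hD n true
    simpa using this
  obtain ⟨S, h1, h2, h3⟩ := (hY e).2 i
  rw [hAeq] at h2
  exact ⟨S, h1, h2, h3.tred⟩
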